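/- arXiv:2501.07872 — 3 statements merged into one kernel-verified Lean document; each statement's English description precedes it below -/
import Mathlib

section
/- There exists an absolute constant C > 0 such that for all even integers ℓ and k with 2 ≤ ℓ < k, one has h^{hol}(ℓ,k) ≤ (C/(k−ℓ)) · ((k−ℓ)/(2(k−1)))^{(k−ℓ)/2}. -/
open Real

/-- The spectral weight `h^hol(ℓ,k)` from the paper, for positive even integers `ℓ ≤ k`. -/
noncomputable def hhol (ℓ k : ℕ) : ℝ :=
  (1 / π) * (Real.Gamma k / Real.Gamma ((k : ℝ) - 1/2) ^ 2) *
    (Real.Gamma (((k : ℝ) + ℓ - 1) / 2) ^ 2 * Real.Gamma (((k : ℝ) - ℓ + 1) / 2) ^ 2) /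
    (Real.Gamma (((k : ℝ) + ℓ) / 2) * Real.Gamma (((k : ℝ) - ℓ) / 2 + 1))

theorem Gamma_add_half_sq_le {x : ℝ} (hx : 0 < x) :
    Real.Gamma (x + 1 / 2) ^ 2 ≤ Real.Gamma x * Real.Gamma (x + 1) := by
  have h := Real.Gamma_mul_add_mul_le_rpow_Gamma_mul_rpow_Gamma hx (by linarith : 0 < x + 1)
    (by norm_num : (0 : ℝ) < 1 / 2) (by norm_num : (0 : ℝ) < 1 / 2) (by norm_num)
  have h1 := Real.Gamma_pos_of_pos hx
  have h2 := Real.Gamma_pos_of_pos (by linarith : 0 < x + 1)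
  rw [← Real.sqrt_eq_rpow, ← Real.sqrt_eq_rpow,
    show 1 / 2 * x + 1 / 2 * (x + 1) = x + 1 / 2 by ring] at h
  have h3 := Real.Gamma_pos_of_pos (by linarith : 0 < x + 1 / 2)
  calc _ ≤ (√(Real.Gamma x) * √(Real.Gamma (x + 1))) ^ 2 := by gcongr
    _ = _ := by rw [mul_pow, Real.sq_sqrt h1.le, Real.sq_sqrt h2.le]

theorem pow_mul_factorial_le_pow_mul_descFactorial {n N : ℕ} (h : n ≤ N) :
    N ^ n * n.factorial ≤ n ^ n * N.descFactorial n := by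
  have key (m : ℕ) : m ^ n = ∏ _i ∈ Finset.range n, m := by simp
  rw [← Nat.descFactorial_self, Nat.descFactorial_eq_prod_range, Nat.descFactorial_eq_prod_range,
    key N, key n, ← Finset.prod_mul_distrib, ← Finset.prod_mul_distrib]
  refine Finset.prod_le_prod' fun i _ => ?_
  rw [Nat.mul_sub, Nat.mul_sub, mul_comm n N]
  exact Nat.sub_le_sub_left (Nat.mul_le_mul_right i h) _

theorem succ_pow_le_two_mul_pow {n N : ℕ} (h : 2 * n ≤ N) :
    ((N : ℝ) + 1) ^ n ≤ 2 * (N : ℝ) ^ n := by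
  have hN : (0 : ℝ) < N + 1 := by positivity
  have hn : (2 : ℝ) * n ≤ N := by exact_mod_cast h
  have hle : 1 / ((N : ℝ) + 1) ≤ 1 := by
    rw [div_le_one hN]; linarith [Nat.cast_nonneg (α := ℝ) N]
  have hb := one_add_mul_le_pow (a := -(1 / ((N : ℝ) + 1))) (by linarith) n
  have hfrac : (n : ℝ) * (1 / (N + 1)) ≤ 1 / 2 := by
    rw [mul_one_div, div_le_iff₀ hN]; linarith
  rw [show 1 + -(1 / ((N : ℝ) + 1)) = N / (N + 1) by field_simp; ring, div_pow] at hb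
  have h2 : 1 / 2 ≤ (N : ℝ) ^ n / (N + 1) ^ n := by linarith
  rw [le_div_iff₀ (by positivity)] at h2
  linarith

/-- With `k = L + 2 + 2 n`, `ℓ = L + 2`, log-convexity of `Γ` reduces the weight to factorials. -/
theorem hhol_le_factorial (L n : ℕ) (hn : 1 ≤ n) :
    hhol (L + 2) (L + 2 + 2 * n) ≤
      (2 / 3) * (((L + n).factorial : ℝ) * (n - 1).factorial / (L + 2 * n).factorial) := by
  obtain ⟨m, rfl⟩ : ∃ m, n = m + 1 := ⟨n - 1, by omega⟩
  set N : ℕ := L + 2 * (m + 1) with hN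
  have hN2 : (2 : ℝ) ≤ N := by exact_mod_cast (by omega : 2 ≤ N)
  have hNr : (N : ℝ) = L + 2 * (m + 1) := by simp [hN]
  have hNp : Real.Gamma ((N : ℝ) + 1) = N.factorial := Real.Gamma_nat_eq_factorial N
  have hNs : Real.Gamma ((N : ℝ) + 1 + 1) = (N + 1) * N.factorial := by
    rw [Real.Gamma_add_one (by positivity), hNp]
  have hden : ((N : ℝ) + 1 / 2) * (N.factorial : ℝ) ^ 2 ≤ Real.Gamma ((N : ℝ) + 3 / 2) ^ 2 := by
    have h := Gamma_add_half_sq_le (by linarith : (0 : ℝ) < N + 1 / 2)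
    rw [show (N : ℝ) + 1 / 2 + 1 / 2 = N + 1 by ring, hNp] at h
    have h3 := Real.Gamma_add_one (by positivity : (N : ℝ) + 1 / 2 ≠ 0)
    rw [show (N : ℝ) + 3 / 2 = N + 1 / 2 + 1 by ring]
    calc _ ≤ ((N : ℝ) + 1 / 2) *
          (Real.Gamma (N + 1 / 2) * Real.Gamma (N + 1 / 2 + 1)) := by gcongr
      _ = _ := by rw [h3]; ring
  have hA := Gamma_add_half_sq_le (by positivity : (0 : ℝ) < (L + (m + 1) : ℕ) + 1)
  have hB := Gamma_add_half_sq_le (by positivity : (0 : ℝ) < (m : ℝ) + 1)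
  have hAp := Real.Gamma_nat_eq_factorial (L + (m + 1))
  have hBp := Real.Gamma_nat_eq_factorial m
  rw [hAp] at hA
  rw [hBp] at hB
  have hA0 : 0 < Real.Gamma (((L + (m + 1) : ℕ) : ℝ) + 1 + 1) := Real.Gamma_pos_of_pos (by positivity)
  have hB0 : 0 < Real.Gamma ((m : ℝ) + 1 + 1) := Real.Gamma_pos_of_pos (by positivity)
  have hNf : (0 : ℝ) < N.factorial := by exact_mod_cast N.factorial_pos
  have hpi : 1 / π ≤ 1 / 3 := one_div_le_one_div_of_le (by norm_num) Real.pi_gt_three.le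
  have hq : Real.Gamma ((N : ℝ) + 1 + 1) / Real.Gamma ((N : ℝ) + 3 / 2) ^ 2 ≤
      2 / N.factorial := by
    rw [hNs, div_le_div_iff₀ (lt_of_lt_of_le (by positivity) hden) hNf]
    nlinarith [sq_nonneg (N.factorial : ℝ)]
  unfold hhol
  push_cast at hA hA0 ⊢
  rw [show (L : ℝ) + 2 + 2 * (m + 1) = N + 1 + 1 by rw [hNr]; ring,
    show (N : ℝ) + 1 + 1 - 1 / 2 = N + 3 / 2 by ring,
    show ((N : ℝ) + 1 + 1 + (L + 2) - 1) / 2 = L + (m + 1) + 1 + 1 / 2 by rw [hNr]; ring,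
    show ((N : ℝ) + 1 + 1 - (L + 2) + 1) / 2 = m + 1 + 1 / 2 by rw [hNr]; ring,
    show ((N : ℝ) + 1 + 1 + (L + 2)) / 2 = L + (m + 1) + 1 + 1 by rw [hNr]; ring,
    show ((N : ℝ) + 1 + 1 - (L + 2)) / 2 + 1 = m + 1 + 1 by rw [hNr]; ring, mul_div_assoc]
  have hr : Real.Gamma ((L : ℝ) + (m + 1) + 1 + 1 / 2) ^ 2 * Real.Gamma ((m : ℝ) + 1 + 1 / 2) ^ 2 /
      (Real.Gamma ((L : ℝ) + (m + 1) + 1 + 1) * Real.Gamma ((m : ℝ) + 1 + 1)) ≤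
      ((L + (m + 1)).factorial : ℝ) * m.factorial := by
    rw [div_le_iff₀ (by positivity)]
    refine (mul_le_mul hA hB (by positivity) (by positivity)).trans_eq (by ring)
  have hq0 : 0 ≤ Real.Gamma ((N : ℝ) + 1 + 1) / Real.Gamma ((N : ℝ) + 3 / 2) ^ 2 := by
    rw [hNs]; positivity
  calc _ ≤ 1 / 3 * (2 / (N.factorial : ℝ)) *
        (((L + (m + 1)).factorial : ℝ) * m.factorial) := by
        gcongr
    _ = _ := by ring

theorem factorial_ratio_le (L n : ℕ) (hn : 1 ≤ n) :
    ((L + n).factorial : ℝ) * (n - 1).factorial / (L + 2 * n).factorial ≤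
      2 / n * ((n : ℝ) / ((L + 2 * n : ℕ) + 1)) ^ n := by
  have hnN : n ≤ L + 2 * n := by omega
  have hd := Nat.factorial_mul_descFactorial hnN
  rw [show L + 2 * n - n = L + n by omega] at hd
  have h1 : (((L + 2 * n : ℕ) : ℝ)) ^ n * n.factorial ≤
      (n : ℝ) ^ n * (L + 2 * n).descFactorial n := by
    exact_mod_cast pow_mul_factorial_le_pow_mul_descFactorial hnN
  have h2 := succ_pow_le_two_mul_pow (show 2 * n ≤ L + 2 * n by omega)
  have hf : (n.factorial : ℝ) = n * (n - 1).factorial := by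
    exact_mod_cast (Nat.mul_factorial_pred (by omega)).symm
  have hn0 : (0 : ℝ) < n := by exact_mod_cast hn
  have hF : (0 : ℝ) < (L + n).factorial := by exact_mod_cast (L + n).factorial_pos
  have hD : (0 : ℝ) < (L + 2 * n).descFactorial n := by
    exact_mod_cast Nat.pos_of_ne_zero (by simp [Nat.descFactorial_eq_zero_iff_lt]; omega)
  rw [← hd, Nat.cast_mul, mul_div_mul_left _ _ hF.ne', div_pow, div_mul_div_comm,
    div_le_div_iff₀ hD (by positivity)]
  calc _ = (((L + 2 * n : ℕ) : ℝ) + 1) ^ n * n.factorial := by rw [hf]; ring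
    _ ≤ 2 * ((L + 2 * n : ℕ) : ℝ) ^ n * n.factorial := by gcongr
    _ ≤ _ := by linarith

/-- There is an absolute constant `C > 0` such that for all even integers `2 ≤ ℓ < k`,
`h^hol(ℓ,k) ≤ (C/(k-ℓ)) ((k-ℓ)/(2(k-1)))^((k-ℓ)/2)`. -/
theorem stmt0 : ∃ C : ℝ, 0 < C ∧ ∀ ℓ k : ℕ, Even ℓ → Even k → 2 ≤ ℓ → ℓ < k →
    hhol ℓ k ≤ (C / ((k : ℝ) - ℓ)) *
      (((k : ℝ) - ℓ) / (2 * ((k : ℝ) - 1))) ^ ((k - ℓ) / 2) := by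
  refine ⟨4, by norm_num, fun ℓ k hℓ hk h2 hlt => ?_⟩
  obtain ⟨a, ha⟩ := hℓ
  obtain ⟨b, hb⟩ := hk
  obtain ⟨L, rfl⟩ : ∃ L, ℓ = L + 2 := ⟨ℓ - 2, by omega⟩
  obtain ⟨n, rfl⟩ : ∃ n, k = L + 2 + 2 * n := ⟨b - a, by omega⟩
  have hn : 1 ≤ n := by omega
  have hn0 : (0 : ℝ) < n := by exact_mod_cast hn
  have h := (hhol_le_factorial L n hn).trans
    (mul_le_mul_of_nonneg_left (factorial_ratio_le L n hn) (by norm_num))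
  rw [show (L + 2 + 2 * n - (L + 2)) / 2 = n by omega]
  push_cast at h ⊢
  rw [show (L : ℝ) + 2 + 2 * n - (L + 2) = 2 * n by ring,
    show 2 * ((L : ℝ) + 2 + 2 * n - 1) = 2 * (L + 2 * n + 1) by ring,
    mul_div_mul_left _ _ (two_ne_zero' ℝ)]
  refine h.trans ?_
  rw [← mul_assoc]
  gcongr
  rw [← mul_div_assoc, div_le_div_iff₀ hn0 (by positivity)]
  linarith
end

section
/- There exist absolute constants C ≥ 0 and K ≥ 2 such that for every real number k ≥ K and every t ∈ ℝ, the quantity A(t,k) := (k/2) log(1+4t²/k²) − 2|t| arctan(2|t|/k) satisfies: (i) A(t,k) ≤ C if |t| ≤ √k; (ii) A(t,k) ≤ −t²/k if √k ≤ |t| ≤ k; (iii) A(t,k) ≤ −|t| if |t| > k. -/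
open Real

theorem half_le_arctan {x : ℝ} (h0 : 0 ≤ x) (h2 : x ≤ 2) : x / 2 ≤ arctan x := by
  have hc : 1 / 2 ≤ cos (x / 2) := by
    have := Real.one_sub_sq_div_two_le_cos (x := x / 2)
    nlinarith
  have hs : sin (x / 2) ≤ x / 2 := Real.sin_le (by linarith)
  have hpi := Real.pi_gt_three
  rw [← Real.arctan_tan (x := x / 2) (by linarith) (by linarith)]
  apply Real.arctan_mono
  rw [Real.tan_eq_sin_div_cos, div_le_iff₀ (by linarith)]
  nlinarith

theorem hasDerivAt_two_mul_arctan_sub_log (x : ℝ) :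
    HasDerivAt (fun y : ℝ => 2 * y * arctan y - log (1 + y ^ 2)) (2 * arctan x) x := by
  have hx : 1 + x ^ 2 ≠ 0 := by positivity
  have h1 : HasDerivAt (fun y : ℝ => 1 + y ^ 2) (2 * x) x := by
    simpa using (hasDerivAt_pow 2 x).const_add 1
  have h2 := (((hasDerivAt_id' x).const_mul 2).mul (Real.hasDerivAt_arctan x)).sub (h1.log hx)
  refine h2.congr_deriv ?_
  field_simp
  ring

theorem sq_div_two_le_two_mul_arctan_sub_log {x : ℝ} (h0 : 0 ≤ x) (h2 : x ≤ 2) :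
    x ^ 2 / 2 ≤ 2 * x * arctan x - log (1 + x ^ 2) := by
  have hd (y : ℝ) : HasDerivAt
      (fun y : ℝ => 2 * y * arctan y - log (1 + y ^ 2) - y ^ 2 / 2) (2 * arctan y - y) y := by
    refine ((hasDerivAt_two_mul_arctan_sub_log y).sub
      ((hasDerivAt_pow 2 y).div_const 2)).congr_deriv ?_
    norm_num
  have hm : MonotoneOn
      (fun y : ℝ => 2 * y * arctan y - log (1 + y ^ 2) - y ^ 2 / 2) (Set.Icc 0 2) := by
    refine monotoneOn_of_deriv_nonneg (convex_Icc 0 2)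
      (fun y _ => (hd y).continuousAt.continuousWithinAt)
      (fun y _ => (hd y).differentiableAt.differentiableWithinAt) fun y hy => ?_
    rw [interior_Icc] at hy
    rw [(hd y).deriv]
    linarith [half_le_arctan hy.1.le hy.2.le]
  have := hm (Set.left_mem_Icc.2 zero_le_two) ⟨h0, h2⟩ h0
  norm_num at this
  linarith

theorem le_two_mul_arctan_sub_log {x : ℝ} (h2 : 2 ≤ x) :
    x ≤ 2 * x * arctan x - log (1 + x ^ 2) := by
  have hd (y : ℝ) : HasDerivAt
      (fun y : ℝ => 2 * y * arctan y - log (1 + y ^ 2) - y) (2 * arctan y - 1) y :=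
    (hasDerivAt_two_mul_arctan_sub_log y).sub (hasDerivAt_id' y)
  have hm : MonotoneOn
      (fun y : ℝ => 2 * y * arctan y - log (1 + y ^ 2) - y) (Set.Ici 2) := by
    refine monotoneOn_of_deriv_nonneg (convex_Ici 2)
      (fun y _ => (hd y).continuousAt.continuousWithinAt)
      (fun y _ => (hd y).differentiableAt.differentiableWithinAt) fun y hy => ?_
    rw [interior_Ici] at hy
    rw [(hd y).deriv]
    linarith [half_le_arctan zero_le_two le_rfl, Real.arctan_mono (le_of_lt hy)]
  have h := hm Set.self_mem_Ici h2 h2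
  have h' := sq_div_two_le_two_mul_arctan_sub_log zero_le_two le_rfl
  have h4 : (2 : ℝ) ^ 2 / 2 = 2 := by norm_num
  rw [h4] at h'
  dsimp only at h
  linarith

/-- Elementary inequalities for `A(t,k) = (k/2) log(1+4t²/k²) − 2|t| arctan(2|t|/k)`
in the three ranges `|t| ≤ √k`, `√k ≤ |t| ≤ k`, `|t| > k`. -/
theorem stmt5 : ∃ C K : ℝ, 0 ≤ C ∧ 2 ≤ K ∧ ∀ k : ℝ, K ≤ k → ∀ t : ℝ,
    (|t| ≤ Real.sqrt k →
      (k / 2) * Real.log (1 + 4 * t ^ 2 / k ^ 2) - 2 * |t| * Real.arctan (2 * |t| / k) ≤ C) ∧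
    (Real.sqrt k ≤ |t| ∧ |t| ≤ k →
      (k / 2) * Real.log (1 + 4 * t ^ 2 / k ^ 2) - 2 * |t| * Real.arctan (2 * |t| / k)
        ≤ -t ^ 2 / k) ∧
    (k < |t| →
      (k / 2) * Real.log (1 + 4 * t ^ 2 / k ^ 2) - 2 * |t| * Real.arctan (2 * |t| / k)
        ≤ -|t|) := by
  refine ⟨0, 2, le_rfl, le_rfl, fun k hk t => ?_⟩
  have hk0 : 0 < k := by linarith
  obtain ⟨x, hx⟩ : ∃ x, x = 2 * |t| / k := ⟨_, rfl⟩
  have hx0 : 0 ≤ x := by rw [hx]; positivity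
  have ht : |t| = k * x / 2 := by rw [hx]; field_simp
  have hsq : t ^ 2 = (k * x / 2) ^ 2 := by rw [← ht, sq_abs]
  have hlog : 1 + 4 * t ^ 2 / k ^ 2 = 1 + x ^ 2 := by rw [hsq]; field_simp; ring
  have hA : k / 2 * log (1 + 4 * t ^ 2 / k ^ 2) - 2 * |t| * arctan (2 * |t| / k) =
      -(k / 2 * (2 * x * arctan x - log (1 + x ^ 2))) := by
    rw [hlog, ← hx, ht]; ring
  have hsmall (h : |t| ≤ k) : k / 2 * log (1 + 4 * t ^ 2 / k ^ 2) -
      2 * |t| * arctan (2 * |t| / k) ≤ -t ^ 2 / k := by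
    have hx2 : x ≤ 2 := by rw [hx, div_le_iff₀ hk0]; linarith
    have hq : -t ^ 2 / k = -(k / 2 * (x ^ 2 / 2)) := by rw [hsq]; field_simp
    rw [hA, hq]
    exact neg_le_neg (mul_le_mul_of_nonneg_left
      (sq_div_two_le_two_mul_arctan_sub_log hx0 hx2) (by positivity))
  refine ⟨fun h => ?_, fun h => hsmall h.2, fun h => ?_⟩
  · have hsk : √k ≤ k := by
      rw [Real.sqrt_le_iff]
      exact ⟨hk0.le, by nlinarith⟩
    refine (hsmall (h.trans hsk)).trans ?_
    exact div_nonpos_of_nonpos_of_nonneg (neg_nonpos.2 (sq_nonneg t)) hk0.le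
  · have hx2 : 2 ≤ x := by rw [hx, le_div_iff₀ hk0]; linarith
    have := mul_le_mul_of_nonneg_left (le_two_mul_arctan_sub_log hx2) (half_pos hk0).le
    rw [hA, ht]
    linarith
end

section
/- There exist absolute constants C ≥ 0 and K ≥ 2 such that for every real number k ≥ K and every t ∈ ℝ, the quantity B(t,k) := (1/2)(k−1/2) log(1+t²/(k−1/2)²) − |t| arctan(2|t|) satisfies: (i) B(t,k) ≤ C if |t| ≤ √k; (ii) B(t,k) ≤ −t²/k if √k ≤ |t| ≤ k; (iii) B(t,k) ≤ −|t| if |t| ≥ k. -/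
open Real

/-- A linear lower bound for `s * arctan (2 * s)`, with slope just below `π / 2`. -/
lemma linear_le_mul_arctan_two_mul {s : ℝ} (hs : 0 < s) :
    1.57 * s - 1 / 2 ≤ s * arctan (2 * s) := by
  have hinv : arctan (2 * s)⁻¹ = π / 2 - arctan (2 * s) :=
    arctan_inv_of_pos (by positivity)
  have hle : arctan (2 * s)⁻¹ ≤ (2 * s)⁻¹ := by
    have h := le_tan (arctan_nonneg.2 (show 0 ≤ (2 * s)⁻¹ by positivity)) (arctan_lt_pi_div_two _)
    rwa [tan_arctan] at h
  have hmul : s * (2 * s)⁻¹ = 1 / 2 := by field_simp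
  have hpi := pi_gt_d2
  have hbound : s * (1.57 - (2 * s)⁻¹) ≤ s * arctan (2 * s) := by
    gcongr
    linarith
  linarith

/-- Beyond `1`, half of `log (1 + x ^ 2)` is below a line of slope less than `π / 2 - 1`. -/
lemma half_log_one_add_sq_le {x : ℝ} (hx : 1 ≤ x) :
    1 / 2 * log (1 + x ^ 2) ≤ 0.54 * x := by
  have hx0 : 0 < x := by linarith
  have hsq : log (1 + x ^ 2) ≤ log (2 * x ^ 2) := log_le_log (by positivity) (by nlinarith)
  rw [log_mul (by norm_num) (by positivity), log_pow] at hsq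
  have hdiv := log_le_sub_one_of_pos (show 0 < x / 2 by positivity)
  rw [log_div hx0.ne' (by norm_num)] at hdiv
  have hlog2 := log_two_lt_d9
  push_cast at hsq
  linarith

/-- The bound `log (1 + x) ≤ x`, scaled. -/
lemma half_mul_log_one_add_sq_div_sq_le {m : ℝ} (hm : 0 < m) (t : ℝ) :
    1 / 2 * m * log (1 + t ^ 2 / m ^ 2) ≤ t ^ 2 / (2 * m) := by
  have hlog := log_le_sub_one_of_pos (show 0 < 1 + t ^ 2 / m ^ 2 by positivity)
  calc 1 / 2 * m * log (1 + t ^ 2 / m ^ 2) ≤ 1 / 2 * m * (t ^ 2 / m ^ 2) := by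
        gcongr
        linarith
    _ = t ^ 2 / (2 * m) := by field_simp

/-- Elementary inequalities for
`B(t,k) = (1/2)(k−1/2) log(1+t²/(k−1/2)²) − |t| arctan(2|t|)`
in the three ranges `|t| ≤ √k`, `√k ≤ |t| ≤ k`, `|t| ≥ k`. -/
theorem stmt6 : ∃ C K : ℝ, 0 ≤ C ∧ 2 ≤ K ∧ ∀ k : ℝ, K ≤ k → ∀ t : ℝ,
    (|t| ≤ Real.sqrt k →
      (1/2) * (k - 1/2) * Real.log (1 + t ^ 2 / (k - 1/2) ^ 2) - |t| * Real.arctan (2 * |t|)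
        ≤ C) ∧
    (Real.sqrt k ≤ |t| ∧ |t| ≤ k →
      (1/2) * (k - 1/2) * Real.log (1 + t ^ 2 / (k - 1/2) ^ 2) - |t| * Real.arctan (2 * |t|)
        ≤ -t ^ 2 / k) ∧
    (k ≤ |t| →
      (1/2) * (k - 1/2) * Real.log (1 + t ^ 2 / (k - 1/2) ^ 2) - |t| * Real.arctan (2 * |t|)
        ≤ -|t|) := by
  refine ⟨1, 100, by norm_num, by norm_num, fun k hk t => ?_⟩
  have hm : 0 < k - 1 / 2 := by linarith
  have hk0 : 0 < k := by linarith
  have hlog := half_mul_log_one_add_sq_div_sq_le hm t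
  have hsqrt : 10 ≤ √k := le_sqrt_of_sq_le (by linarith)
  refine ⟨fun ht => ?_, fun ⟨ht, htk⟩ => ?_, fun ht => ?_⟩
  · have hsq : t ^ 2 ≤ k := by
      rw [← sq_abs, ← sq_sqrt hk0.le]
      gcongr
    have hdiv : t ^ 2 / (2 * (k - 1 / 2)) ≤ 1 := by
      rw [div_le_one (by positivity)]
      linarith
    have harctan : 0 ≤ |t| * arctan (2 * |t|) :=
      mul_nonneg (abs_nonneg t) (arctan_nonneg.2 (by positivity))
    linarith
  · have harctan := linear_le_mul_arctan_two_mul (show 0 < |t| by linarith)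
    have hquot : t ^ 2 / k ≤ |t| := by
      rw [div_le_iff₀ hk0, ← sq_abs, sq]
      gcongr
    have hcompare : t ^ 2 / (2 * (k - 1 / 2)) ≤ 0.51 * (t ^ 2 / k) := by
      rw [← mul_div_assoc, div_le_div_iff₀ (by positivity) hk0]
      nlinarith [mul_nonneg (sq_nonneg t) (show 0 ≤ k - 100 by linarith), sq_nonneg t]
    rw [neg_div]
    linarith
  · have harctan := linear_le_mul_arctan_two_mul (show 0 < |t| by linarith)
    have hx : 1 ≤ |t| / (k - 1 / 2) := by
      rw [one_le_div hm]
      linarith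
    have hhalf := mul_le_mul_of_nonneg_left (half_log_one_add_sq_le hx) hm.le
    rw [div_pow, sq_abs] at hhalf
    have hcancel : (k - 1 / 2) * (0.54 * (|t| / (k - 1 / 2))) = 0.54 * |t| := by
      rw [mul_left_comm, mul_div_cancel₀ _ hm.ne']
    linarith
end
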